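/- The elliptic Shibukawa–Ueno R-operator R(ξ)f(z₁,z₂) = σ_μ(z₁₂)f(z₁,z₂) − σ_ξ(z₁₂)f(z₂,z₁) satisfies the Yang–Baxter equation R₁₂(ξ₁₂)R₁₃(ξ₁₃)R₂₃(ξ₂₃) = R₂₃(ξ₂₃)R₁₃(ξ₁₃)R₁₂(ξ₁₂), where ξ_{ij} = ξ_i − ξ_j and z₁₂ = z₁ − z₂. -/

import Mathlib

open Complex

/-- Jacobi theta function `θ₁(z,τ) = Σ_{n∈ℤ+1/2} exp(iπn²τ + 2πin(z+1/2))`. -/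
noncomputable def theta1 (z τ : ℂ) : ℂ :=
  ∑' n : ℤ, Complex.exp (Real.pi * I * ((n : ℂ) + 1/2)^2 * τ +
    2 * Real.pi * I * ((n : ℂ) + 1/2) * (z + 1/2))

/-- `θ₁′(0,τ)`, the derivative of `θ₁` in the first variable at `0`. -/
noncomputable def theta1'0 (τ : ℂ) : ℂ := deriv (fun w => theta1 w τ) 0

/-- The function `σ_μ(z) = θ₁(z−μ,τ)θ₁′(0,τ)/(θ₁(z,τ)θ₁(−μ,τ))`. -/
noncomputable def sigmaE (τ μ z : ℂ) : ℂ :=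
  theta1 (z - μ) τ * theta1'0 τ / (theta1 z τ * theta1 (-μ) τ)

/-- The lattice `ℤ + τℤ`. -/
def lattice (τ : ℂ) : Set ℂ := {w | ∃ m n : ℤ, w = (m : ℂ) + (n : ℂ) * τ}

/-- Elliptic Shibukawa–Ueno R-operator acting on variables 1,2 of a function of
three variables. -/
noncomputable def Rell12 (τ μ ξ : ℂ) (f : ℂ → ℂ → ℂ → ℂ) : ℂ → ℂ → ℂ → ℂ :=
  fun z1 z2 z3 => sigmaE τ μ (z1 - z2) * f z1 z2 z3 - sigmaE τ ξ (z1 - z2) * f z2 z1 z3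

/-- Elliptic Shibukawa–Ueno R-operator acting on variables 1,3. -/
noncomputable def Rell13 (τ μ ξ : ℂ) (f : ℂ → ℂ → ℂ → ℂ) : ℂ → ℂ → ℂ → ℂ :=
  fun z1 z2 z3 => sigmaE τ μ (z1 - z3) * f z1 z2 z3 - sigmaE τ ξ (z1 - z3) * f z3 z2 z1

/-- Elliptic Shibukawa–Ueno R-operator acting on variables 2,3. -/
noncomputable def Rell23 (τ μ ξ : ℂ) (f : ℂ → ℂ → ℂ → ℂ) : ℂ → ℂ → ℂ → ℂ :=
  fun z1 z2 z3 => sigmaE τ μ (z2 - z3) * f z1 z2 z3 - sigmaE τ ξ (z2 - z3) * f z1 z3 z2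

theorem theta1_eq_jacobiTheta₂ (z τ : ℂ) :
    theta1 z τ = cexp (Real.pi * I * τ / 4 + Real.pi * I * (z + 1 / 2)) *
      jacobiTheta₂ (z + 1 / 2 + τ / 2) τ := by
  rw [theta1, jacobiTheta₂, ← tsum_mul_left]
  refine tsum_congr fun n => ?_
  rw [jacobiTheta₂_term, ← Complex.exp_add]
  ring_nf

theorem theta1_neg (z τ : ℂ) : theta1 (-z) τ = -theta1 z τ := by
  rw [theta1, theta1, ← tsum_neg, ← (Equiv.subLeft (-1 : ℤ)).tsum_eq]
  refine tsum_congr fun n => ?_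
  rw [Equiv.subLeft_apply, ← Complex.exp_add_pi_mul_I, Complex.exp_eq_exp_iff_exists_int]
  exact ⟨-(n + 1), by push_cast; ring⟩

theorem theta1_add_one (z τ : ℂ) : theta1 (z + 1) τ = -theta1 z τ := by
  rw [theta1_eq_jacobiTheta₂, theta1_eq_jacobiTheta₂,
    show z + 1 + 1 / 2 + τ / 2 = z + 1 / 2 + τ / 2 + 1 by ring, jacobiTheta₂_add_left,
    show (Real.pi * I * τ / 4 + Real.pi * I * (z + 1 + 1 / 2) : ℂ) =
      Real.pi * I * τ / 4 + Real.pi * I * (z + 1 / 2) + Real.pi * I by ring,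
    Complex.exp_add _ (Real.pi * I : ℂ), Complex.exp_pi_mul_I]
  ring

theorem theta1_add_tau (z τ : ℂ) :
    theta1 (z + τ) τ = -cexp (-(Real.pi * I * τ) - 2 * Real.pi * I * z) * theta1 z τ := by
  rw [theta1_eq_jacobiTheta₂, theta1_eq_jacobiTheta₂,
    show z + τ + 1 / 2 + τ / 2 = z + 1 / 2 + τ / 2 + τ by ring, jacobiTheta₂_add_left',
    ← mul_assoc, ← mul_assoc, ← Complex.exp_add, neg_mul (cexp _), ← Complex.exp_add,
    ← Complex.exp_add_pi_mul_I]
  congr 1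
  rw [Complex.exp_eq_exp_iff_exists_int]
  exact ⟨-1, by push_cast; ring⟩

theorem differentiable_theta1 {τ : ℂ} (hτ : 0 < τ.im) :
    Differentiable ℂ fun z => theta1 z τ := by
  simp_rw [theta1_eq_jacobiTheta₂]
  intro z
  refine DifferentiableAt.mul (by fun_prop) ?_
  exact (differentiableAt_jacobiTheta₂_fst (z + 1 / 2 + τ / 2) hτ).fun_comp' z
    (f := fun z => z + 1 / 2 + τ / 2) (by fun_prop)

theorem integral_jacobiTheta₂_term (n : ℤ) (τ : ℂ) :
    ∫ x in (0 : ℝ)..1, jacobiTheta₂_term n x τ = if n = 0 then 1 else 0 := by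
  split_ifs with hn
  · simp [hn, jacobiTheta₂_term]
  · have hc : (2 * Real.pi * I * n : ℂ) ≠ 0 := by simp [hn, Real.pi_ne_zero]
    simp_rw [jacobiTheta₂_term, Complex.exp_add]
    rw [intervalIntegral.integral_mul_const, integral_exp_mul_complex hc]
    have : cexp (2 * Real.pi * I * n * (1 : ℝ)) = 1 := by
      rw [← Complex.exp_int_mul_two_pi_mul_I n]; congr 1; push_cast; ring
    rw [this]
    simp

theorem integral_jacobiTheta₂ {τ : ℂ} (hτ : 0 < τ.im) :
    ∫ x in (0 : ℝ)..1, jacobiTheta₂ x τ = 1 := by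
  have hcont (n : ℤ) : Continuous fun x : ℝ => jacobiTheta₂_term n x τ := by
    unfold jacobiTheta₂_term; fun_prop
  have h := intervalIntegral.tsum_intervalIntegral_eq_of_summable_norm (a := 0) (b := 1)
    (f := fun n : ℤ => (⟨fun x : ℝ => jacobiTheta₂_term n x τ, hcont n⟩ : C(ℝ, ℂ))) ?_
  · simp only [ContinuousMap.coe_mk, integral_jacobiTheta₂_term] at h
    rw [tsum_ite_eq] at h
    exact h.symm
  · refine Summable.of_nonneg_of_le (fun _ => norm_nonneg _) (fun n => ?_)
      ((summable_jacobiTheta₂_term_iff 0 τ).2 hτ).norm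
    rw [ContinuousMap.norm_le _ (norm_nonneg _)]
    intro x
    simp [norm_jacobiTheta₂_term]

theorem exists_theta1_ne_zero {τ : ℂ} (hτ : 0 < τ.im) : ∃ z, theta1 z τ ≠ 0 := by
  by_contra! h
  have h0 (x : ℂ) : jacobiTheta₂ x τ = 0 := by
    have hx := h (x - 1 / 2 - τ / 2)
    rw [theta1_eq_jacobiTheta₂,
      show x - 1 / 2 - τ / 2 + 1 / 2 + τ / 2 = x by ring] at hx
    exact (mul_eq_zero.1 hx).resolve_left (Complex.exp_ne_zero _)
  simpa [h0] using integral_jacobiTheta₂ hτ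

theorem tsum_int_prod_eq_add (f : ℤ × ℤ → ℂ) (hf : Summable f) :
    ∑' p, f p = ∑' p : ℤ × ℤ, f (p.1 + p.2, p.1 - p.2 - 1) +
      ∑' p : ℤ × ℤ, f (p.1 + p.2, p.1 - p.2) := by
  have ho : Function.Injective fun p : ℤ × ℤ => (p.1 + p.2, p.1 - p.2 - 1) := by
    rintro ⟨a, b⟩ ⟨c, d⟩ h
    simp only [Prod.mk.injEq] at h ⊢
    lia
  have he : Function.Injective fun p : ℤ × ℤ => (p.1 + p.2, p.1 - p.2) := by
    rintro ⟨a, b⟩ ⟨c, d⟩ h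
    simp only [Prod.mk.injEq] at h ⊢
    lia
  refine HasSum.tsum_eq ((ho.hasSum_range_iff.2 (hf.comp_injective ho).hasSum).add_isCompl ?_
    (he.hasSum_range_iff.2 (hf.comp_injective he).hasSum))
  constructor
  · rw [Set.disjoint_iff]
    rintro _ ⟨⟨⟨a, b⟩, rfl⟩, ⟨c, d⟩, h⟩
    simp only [Prod.mk.injEq] at h
    lia
  · rw [codisjoint_iff_le_sup]
    rintro ⟨m, n⟩ -
    rcases Int.even_or_odd' (m + n) with ⟨k, hk | hk⟩
    · exact Or.inr ⟨(k, m - k), by ext <;> simp; lia⟩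
    · exact Or.inl ⟨(k + 1, m - k - 1), by ext <;> simp; lia⟩

/-- `θ₁(x + y) θ₁(x - y)` is an alternating bilinear expression in two series of `x` and of `y`:
the even and the odd part of the theta series of `τ / 2`. -/
theorem theta1_add_mul_theta1_sub (x y : ℂ) {τ : ℂ} (hτ : 0 < τ.im) :
    theta1 (x + y) τ * theta1 (x - y) τ =
      (∑' k : ℤ, jacobiTheta₂_term (2 * k) x (τ / 2)) *
        (∑' k : ℤ, jacobiTheta₂_term (2 * k + 1) y (τ / 2)) -
      (∑' k : ℤ, jacobiTheta₂_term (2 * k + 1) x (τ / 2)) *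
        (∑' k : ℤ, jacobiTheta₂_term (2 * k) y (τ / 2)) := by
  have hs (z : ℂ) : Summable fun n : ℤ => ‖jacobiTheta₂_term n z (τ / 2)‖ :=
    ((summable_jacobiTheta₂_term_iff z _).2 (by simpa using hτ)).norm
  have hE (z : ℂ) : Summable fun n : ℤ => ‖jacobiTheta₂_term (2 * n) z (τ / 2)‖ :=
    (hs z).comp_injective (i := fun n : ℤ => 2 * n) fun a b h => by simpa using h
  have hO (z : ℂ) : Summable fun n : ℤ => ‖jacobiTheta₂_term (2 * n + 1) z (τ / 2)‖ :=
    (hs z).comp_injective (i := fun n : ℤ => 2 * n + 1) fun a b h => by simpa using h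
  have ht (z : ℂ) : Summable fun n : ℤ => ‖cexp (Real.pi * I * ((n : ℂ) + 1/2)^2 * τ +
      2 * Real.pi * I * ((n : ℂ) + 1/2) * (z + 1/2))‖ := by
    refine (((summable_jacobiTheta₂_term_iff (z + 1 / 2 + τ / 2) τ).2 hτ).norm.mul_left
      ‖cexp (Real.pi * I * τ / 4 + Real.pi * I * (z + 1 / 2))‖).congr fun n => ?_
    rw [← norm_mul, jacobiTheta₂_term, ← Complex.exp_add]
    ring_nf
  rw [theta1, theta1, tsum_mul_tsum_of_summable_norm (ht _) (ht _),
    tsum_int_prod_eq_add _ (summable_mul_of_summable_norm (ht _) (ht _)),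
    tsum_mul_tsum_of_summable_norm (hE _) (hO _), tsum_mul_tsum_of_summable_norm (hO _) (hE _),
    sub_eq_add_neg (tsum _), ← tsum_neg]
  congr 1 <;> refine tsum_congr fun ⟨k, l⟩ => ?_
  · simp only [jacobiTheta₂_term]
    rw [← Complex.exp_add, ← Complex.exp_add, Complex.exp_eq_exp_iff_exists_int]
    exact ⟨k, by push_cast; ring⟩
  · simp only [jacobiTheta₂_term]
    rw [← Complex.exp_add, ← Complex.exp_add, ← Complex.exp_add_pi_mul_I,
      Complex.exp_eq_exp_iff_exists_int]
    exact ⟨k, by push_cast; ring⟩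

/-- The Weierstrass three-term addition formula. -/
theorem theta1_three_term (x y u v : ℂ) {τ : ℂ} (hτ : 0 < τ.im) :
    theta1 (x + y) τ * theta1 (x - y) τ * (theta1 (u + v) τ * theta1 (u - v) τ) -
      theta1 (x + u) τ * theta1 (x - u) τ * (theta1 (y + v) τ * theta1 (y - v) τ) +
      theta1 (x + v) τ * theta1 (x - v) τ * (theta1 (y + u) τ * theta1 (y - u) τ) = 0 := by
  simp only [theta1_add_mul_theta1_sub _ _ hτ]
  ring

/-- Entire functions whose logarithmic derivatives differ by a constant are proportional up to
an exponential factor. -/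
theorem eq_const_mul_exp_mul_of_wronskian {N D : ℂ → ℂ} (hN : Differentiable ℂ N)
    (hD : Differentiable ℂ D) {c p : ℂ} (hp : D p ≠ 0)
    (h : ∀ z, deriv N z * D z = N z * deriv D z + c * (N z * D z)) :
    ∃ C : ℂ, ∀ z, N z = C * cexp (c * z) * D z := by
  obtain ⟨r, hr, hball⟩ := Metric.eventually_nhds_iff_ball.1
    (hD.continuous.continuousAt.eventually_ne hp)
  set g : ℂ → ℂ := fun z => N z * cexp (-(c * z)) / D z with hg
  have hder (z : ℂ) (hz : z ∈ Metric.ball p r) : HasDerivAt g 0 z := by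
    have h1 : HasDerivAt (fun z => cexp (-(c * z))) (cexp (-(c * z)) * -(c * 1)) z :=
      (((hasDerivAt_id z).const_mul c).neg).cexp
    have h2 := ((hN z).hasDerivAt.mul h1).div (hD z).hasDerivAt (hball z hz)
    refine h2.congr_deriv ?_
    rw [div_eq_zero_iff]
    left
    simp only [Pi.mul_apply]
    linear_combination cexp (-(c * z)) * h z
  have hconst (z : ℂ) (hz : z ∈ Metric.ball p r) : g z = g p :=
    Metric.isOpen_ball.is_const_of_deriv_eq_zero (convex_ball p r).isPreconnected
      (fun w hw => (hder w hw).differentiableAt.differentiableWithinAt)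
      (fun w hw => (hder w hw).deriv) hz (Metric.mem_ball_self hr)
  refine ⟨g p, fun z => ?_⟩
  have hR : Differentiable ℂ fun z => g p * cexp (c * z) * D z := by fun_prop
  refine congrFun (AnalyticOnNhd.eq_of_eventuallyEq
    (fun w _ => hN.analyticAt w) (fun w _ => hR.analyticAt w) (z₀ := p) ?_) z
  filter_upwards [Metric.ball_mem_nhds p hr] with w hw
  rw [← hconst w hw, hg]
  have hDw := hball w hw
  simp only [Complex.exp_neg]
  field_simp [Complex.exp_ne_zero]

theorem mem_lattice_of_theta1_eq_zero {τ : ℂ} (hτ : 0 < τ.im) {a : ℂ} (ha : theta1 a τ = 0) :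
    a ∈ lattice τ := by
  have hD := differentiable_theta1 hτ
  set D : ℂ → ℂ := fun z => theta1 z τ with hDdef
  set N : ℂ → ℂ := fun z => D (a - z) with hNdef
  have hN : Differentiable ℂ N := by fun_prop
  have hrel (p q t : ℂ) :
      N p * N q * (D (p + t) * D (q - t)) = N (p + t) * N (q - t) * (D p * D q) := by
    have h := theta1_three_term (a - (p + q) / 2) ((p + q) / 2) ((q - p) / 2)
      ((q - p) / 2 - t) hτ
    ring_nf at h
    simp only [hNdef, hDdef]
    ring_nf
    rw [ha] at h
    linear_combination -h
  obtain ⟨b, hb⟩ := exists_theta1_ne_zero hτ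
  obtain ⟨p, hpN, hpD⟩ : ∃ p, N p ≠ 0 ∧ D p ≠ 0 := by
    by_contra! h
    rcases AnalyticOnNhd.eq_zero_or_eq_zero_of_mul_eq_zero (f := N) (g := D) (U := Set.univ)
      (fun w _ => hN.analyticAt w) (fun w _ => hD.analyticAt w)
      (fun z _ => by by_cases hz : N z = 0 <;> simp [hz, h z]) isPreconnected_univ with h0 | h0
    · exact hb (by simpa [hNdef] using h0 (a - b) trivial)
    · exact hb (h0 b trivial)
  have hwr (z : ℂ) : N z * N p * (deriv D z * D p - D z * deriv D p) =
      (deriv N z * N p - N z * deriv N p) * (D z * D p) := by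
    have key {F : ℂ → ℂ} (hF : Differentiable ℂ F) :
        HasDerivAt (fun t => F (z + t) * F (p - t)) (deriv F z * F p - F z * deriv F p) 0 := by
      have h1 : HasDerivAt (fun t => F (z + t)) (deriv F z) 0 :=
        HasDerivAt.comp_const_add z 0 (by simpa using (hF z).hasDerivAt)
      have h2 : HasDerivAt (fun t => F (p - t)) (-deriv F p) 0 :=
        HasDerivAt.comp_const_sub p 0 (by simpa using (hF p).hasDerivAt)
      refine (h1.mul h2).congr_deriv ?_
      simp [sub_eq_add_neg]
    refine ((key hD).const_mul (N z * N p)).unique ?_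
    simp_rw [hrel z p]
    exact (key hN).mul_const (D z * D p)
  obtain ⟨C, hC⟩ := eq_const_mul_exp_mul_of_wronskian hN hD (p := p)
    (c := deriv N p / N p - deriv D p / D p) hpD (fun z => by
      have := hwr z
      field_simp
      linear_combination -this)
  generalize deriv N p / N p - deriv D p / D p = c at hC
  have hC0 : C * cexp (c * p) ≠ 0 := fun h0 => hpN (by rw [hC, h0, zero_mul])
  have hone : cexp c = 1 := by
    have h1 : N (p + 1) = -N p := by
      have := theta1_add_one (a - (p + 1)) τ
      simp only [hNdef, hDdef]
      rw [show a - p = a - (p + 1) + 1 by ring, this, neg_neg]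
    have h2 := hC (p + 1)
    rw [h1, hC p, hDdef] at h2
    simp only [theta1_add_one, mul_add, mul_one, Complex.exp_add] at h2
    have h3 : C * cexp (c * p) * D p * (cexp c - 1) = 0 := by linear_combination h2
    exact sub_eq_zero.1 ((mul_eq_zero.1 h3).resolve_left (mul_ne_zero hC0 hpD))
  have htau : cexp (c * τ) = cexp (2 * Real.pi * I * a) := by
    have h1 : N (p + τ) = -cexp (-(Real.pi * I * τ) + 2 * Real.pi * I * (a - p)) * N p := by
      have := theta1_add_tau (a - (p + τ)) τ
      simp only [hNdef, hDdef]
      rw [show a - p = a - (p + τ) + τ by ring, this, ← mul_assoc, neg_mul_neg,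
        ← Complex.exp_add, eq_comm]
      ring_nf
      simp
    have h2 := hC (p + τ)
    rw [h1, hC p, hDdef] at h2
    simp only [theta1_add_tau, mul_add, Complex.exp_add] at h2
    rw [mul_sub, Complex.exp_sub, Complex.exp_sub] at h2
    have hE : cexp (-(Real.pi * I * τ)) / cexp (2 * Real.pi * I * p) ≠ 0 :=
      div_ne_zero (Complex.exp_ne_zero _) (Complex.exp_ne_zero _)
    have h3 : C * cexp (c * p) * D p * (cexp (-(Real.pi * I * τ)) / cexp (2 * Real.pi * I * p)) *
        (cexp (c * τ) - cexp (2 * Real.pi * I * a)) = 0 := by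
      linear_combination h2
    exact sub_eq_zero.1 ((mul_eq_zero.1 h3).resolve_left
      (mul_ne_zero (mul_ne_zero hC0 hpD) hE))
  obtain ⟨n, rfl⟩ := Complex.exp_eq_one_iff.1 hone
  obtain ⟨m, hm⟩ := Complex.exp_eq_exp_iff_exists_int.1 htau
  refine ⟨-m, n, ?_⟩
  have h2 : (2 * Real.pi * I : ℂ) ≠ 0 := Complex.two_pi_I_ne_zero
  refine mul_left_cancel₀ h2 ?_
  push_cast
  linear_combination -hm

theorem theta1_ne_zero {τ : ℂ} (hτ : 0 < τ.im) {a : ℂ} (ha : a ∉ lattice τ) :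
    theta1 a τ ≠ 0 :=
  fun h => ha (mem_lattice_of_theta1_eq_zero hτ h)

theorem sigmaE_eq (τ μ z : ℂ) :
    sigmaE τ μ z = -(theta1'0 τ * theta1 (z - μ) τ) / (theta1 z τ * theta1 μ τ) := by
  rw [sigmaE, theta1_neg, mul_neg, div_neg, neg_div, mul_comm (theta1'0 τ)]

theorem sigmaE_neg (τ μ z : ℂ) :
    sigmaE τ μ (-z) = -(theta1'0 τ * theta1 (z + μ) τ) / (theta1 z τ * theta1 μ τ) := by
  rw [sigmaE_eq, show -z - μ = -(z + μ) by ring, theta1_neg, theta1_neg]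
  ring

/-- The three-term identity for `sigmaE`. -/
theorem sigmaE_three_term {τ : ℂ} (hτ : 0 < τ.im) {α β a b : ℂ}
    (hα : theta1 α τ ≠ 0) (hβ : theta1 β τ ≠ 0) (hαβ : theta1 (α + β) τ ≠ 0)
    (ha : theta1 a τ ≠ 0) (hb : theta1 b τ ≠ 0) (hab : theta1 (a + b) τ ≠ 0) :
    sigmaE τ (α + β) (a + b) * sigmaE τ β (-a) + sigmaE τ α a * sigmaE τ (α + β) b =
      sigmaE τ β b * sigmaE τ α (a + b) := by
  have h : theta1 (a + b - (α + β)) τ * theta1 (a + β) τ * (theta1 b τ * theta1 α τ) -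
      theta1 (a + b) τ * theta1 (a - α) τ * (theta1 (b - (α + β)) τ * theta1 (-β) τ) +
      theta1 (a + b - α) τ * theta1 a τ * (theta1 (b - β) τ * theta1 (-(α + β)) τ) = 0 := by
    have h := theta1_three_term (a + (b - α) / 2) ((b - α) / 2 - β) ((b + α) / 2)
      ((b - α) / 2) hτ
    ring_nf at h ⊢
    exact h
  rw [theta1_neg, theta1_neg] at h
  simp only [sigmaE_neg]
  simp only [sigmaE_eq]
  field_simp
  linear_combination theta1'0 τ ^ 2 * h

theorem sigmaE_mul_sub_mul {τ : ℂ} (hτ : 0 < τ.im) {μ α β a b : ℂ} (hμ : theta1 μ τ ≠ 0)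
    (hα : theta1 α τ ≠ 0) (hβ : theta1 β τ ≠ 0) (hαβ : theta1 (α + β) τ ≠ 0)
    (ha : theta1 a τ ≠ 0) (hb : theta1 b τ ≠ 0) (hab : theta1 (a + b) τ ≠ 0) :
    sigmaE τ (α + β) (a + b) *
        (sigmaE τ μ b * sigmaE τ μ (-b) - sigmaE τ μ a * sigmaE τ μ (-a)) =
      sigmaE τ α a * sigmaE τ β a * sigmaE τ (α + β) b -
        sigmaE τ α b * sigmaE τ β b * sigmaE τ (α + β) a := by
  have h1 : sigmaE τ μ b * sigmaE τ μ (-b) - sigmaE τ μ a * sigmaE τ μ (-a) =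
      -(theta1'0 τ ^ 2 * (theta1 (a + b) τ * theta1 (a - b) τ)) /
        (theta1 a τ ^ 2 * theta1 b τ ^ 2) := by
    have h := theta1_three_term a b μ 0 hτ
    simp only [add_zero, sub_zero] at h
    simp only [sigmaE_eq τ μ a, sigmaE_eq τ μ b, sigmaE_neg]
    field_simp
    linear_combination theta1'0 τ ^ 2 * h
  have h2 : theta1 (a - α) τ * theta1 (a - β) τ * (theta1 b τ * theta1 (b - (α + β)) τ) -
      theta1 (a + b - (α + β)) τ * theta1 (a - b) τ * (theta1 β τ * theta1 (-α) τ) +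
      theta1 a τ * theta1 (a - (α + β)) τ * (theta1 (b - α) τ * theta1 (-(b - β)) τ) = 0 := by
    have h := theta1_three_term (a - (α + β) / 2) ((β - α) / 2) (b - (α + β) / 2)
      ((α + β) / 2) hτ
    ring_nf at h ⊢
    exact h
  rw [theta1_neg, theta1_neg] at h2
  rw [h1]
  simp only [sigmaE_eq]
  field_simp
  linear_combination theta1'0 τ ^ 3 * h2

/-- the elliptic Shibukawa–Ueno R-operator satisfies the Yang–Baxter
equation R₁₂(ξ₁₂)R₁₃(ξ₁₃)R₂₃(ξ₂₃) = R₂₃(ξ₂₃)R₁₃(ξ₁₃)R₁₂(ξ₁₂), pointwise where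
all σ's are defined. -/
theorem elliptic_YBE (τ : ℂ) (hτ : 0 < τ.im) (μ ξ1 ξ2 ξ3 : ℂ)
    (hμ : μ ∉ lattice τ)
    (h12 : ξ1 - ξ2 ∉ lattice τ) (h13 : ξ1 - ξ3 ∉ lattice τ) (h23 : ξ2 - ξ3 ∉ lattice τ)
    (f : ℂ → ℂ → ℂ → ℂ) (z1 z2 z3 : ℂ)
    (hz12 : z1 - z2 ∉ lattice τ) (hz13 : z1 - z3 ∉ lattice τ) (hz23 : z2 - z3 ∉ lattice τ) :
    Rell12 τ μ (ξ1 - ξ2) (Rell13 τ μ (ξ1 - ξ3) (Rell23 τ μ (ξ2 - ξ3) f)) z1 z2 z3 =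
    Rell23 τ μ (ξ2 - ξ3) (Rell13 τ μ (ξ1 - ξ3) (Rell12 τ μ (ξ1 - ξ2) f)) z1 z2 z3 := by
  have e13 : ξ1 - ξ3 = (ξ1 - ξ2) + (ξ2 - ξ3) := by ring
  have ez13 : z1 - z3 = (z1 - z2) + (z2 - z3) := by ring
  have nμ := theta1_ne_zero hτ hμ
  have nα := theta1_ne_zero hτ h12
  have nβ := theta1_ne_zero hτ h23
  have nαβ := theta1_ne_zero hτ h13
  have na := theta1_ne_zero hτ hz12
  have nb := theta1_ne_zero hτ hz23
  have nab := theta1_ne_zero hτ hz13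
  simp only [Rell12, Rell13, Rell23]
  rw [← neg_sub z1 z2, ← neg_sub z2 z3]
  rw [e13] at nαβ ⊢
  rw [ez13] at nab ⊢
  generalize ξ1 - ξ2 = α at *
  generalize ξ2 - ξ3 = β at *
  generalize z1 - z2 = a at *
  generalize z2 - z3 = b at *
  have h312 := sigmaE_three_term hτ nα nβ nαβ na nb nab
  have h231 := sigmaE_three_term hτ nβ nα (add_comm α β ▸ nαβ) nb na (add_comm a b ▸ nab)
  rw [add_comm β α, add_comm b a] at h231
  have h321 := sigmaE_mul_sub_mul hτ nμ nα nβ nαβ na nb nab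
  linear_combination f z3 z1 z2 * sigmaE τ μ a * h312 - f z2 z3 z1 * sigmaE τ μ b * h231 +
    f z3 z2 z1 * h321
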